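/- arXiv:2210.16185 — 2 statements merged into one kernel-verified Lean document; each statement's English description precedes it below -/
import Mathlib

section
/- Let φ be the structure function of the spent fuel pool system on the 15 components G₀, G₁, G₂, G₃, S₁, S₂ and L_{i,j} for i, j ∈ {1,2,3}, defined by: φ(c) = true iff there exists a line j ∈ {1,2,3} such that (G₀ works or G_j works), and (S₁ works, or j = 3 and S₂ works), and L_{1,j}, L_{2,j}, L_{3,j} all work. Then φ is coherent, φ has exactly 8 minimal path sets, and φ has exactly 69 minimal cut sets. -/
/-- `S` is a path set of `φ`. -/
def IsPathSet (n : ℕ) (φ : (Fin n → Bool) → Bool) (S : Finset (Fin n)) : Prop :=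
  φ (fun j => decide (j ∈ S)) = true

/-- `S` is a minimal path set of `φ`. -/
def IsMinimalPathSet (n : ℕ) (φ : (Fin n → Bool) → Bool) (S : Finset (Fin n)) : Prop :=
  IsPathSet n φ S ∧ ∀ T : Finset (Fin n), T ⊂ S → ¬ IsPathSet n φ T

/-- `S` is a cut set of `φ`. -/
def IsCutSet (n : ℕ) (φ : (Fin n → Bool) → Bool) (S : Finset (Fin n)) : Prop :=
  φ (fun j => decide (j ∉ S)) = false

/-- `S` is a minimal cut set of `φ`. -/
def IsMinimalCutSet (n : ℕ) (φ : (Fin n → Bool) → Bool) (S : Finset (Fin n)) : Prop :=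
  IsCutSet n φ S ∧ ∀ T : Finset (Fin n), T ⊂ S → ¬ IsCutSet n φ T

/-- The structure function of the spent fuel pool system.  The 15 components are indexed as
`0 = G₀`, `1 = G₁`, `2 = G₂`, `3 = G₃`, `4 = S₁`, `5 = S₂`,
`6 = L₁,₁`, `7 = L₂,₁`, `8 = L₃,₁`, `9 = L₁,₂`, `10 = L₂,₂`, `11 = L₃,₂`,
`12 = L₁,₃`, `13 = L₂,₃`, `14 = L₃,₃`.
The system works iff some line `j ∈ {1,2,3}` has (G₀ or G_j) working, a water source available
(S₁, or S₂ for the third line only), and its three exchangers L₁,ⱼ, L₂,ⱼ, L₃,ⱼ working. -/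
def sfp : (Fin 15 → Bool) → Bool := fun c =>
  ((c 0 || c 1) && c 4 && c 6 && c 7 && c 8) ||
  ((c 0 || c 2) && c 4 && c 9 && c 10 && c 11) ||
  ((c 0 || c 3) && (c 4 || c 5) && c 12 && c 13 && c 14)

/-- An antichain that generates an upward closed family is its set of minimal elements. -/
theorem minimal_eq_of_generates (Q : Finset (Fin 15) → Prop) (K : Finset (Finset (Fin 15)))
    (hQ : ∀ S, Q S ↔ ∃ k ∈ K, k ⊆ S)
    (hK : ∀ k ∈ K, ∀ l ∈ K, k ⊆ l → k = l) :
    {S : Finset (Fin 15) | Q S ∧ ∀ T, T ⊂ S → ¬ Q T} = (K : Set (Finset (Fin 15))) := by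
  ext S
  simp only [Set.mem_ofPred_eq, Finset.mem_coe]
  constructor
  · rintro ⟨h1, h2⟩
    obtain ⟨k, hk, hkS⟩ := (hQ S).1 h1
    rcases hkS.eq_or_ssubset with h | h
    · exact h ▸ hk
    · exact absurd ((hQ k).2 ⟨k, hk, subset_rfl⟩) (h2 k h)
  · intro hS
    refine ⟨(hQ S).2 ⟨S, hS, subset_rfl⟩, fun T hT hQT => ?_⟩
    obtain ⟨k, hk, hkT⟩ := (hQ T).1 hQT
    have h := hK k hk S hS (hkT.trans hT.subset)
    subst h
    exact hT.not_subset hkT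

/-- The minimal path sets. -/
def sfpPaths : Finset (Finset (Fin 15)) :=
  {{0, 4, 6, 7, 8}, {1, 4, 6, 7, 8}, {0, 4, 9, 10, 11}, {2, 4, 9, 10, 11},
   {0, 4, 12, 13, 14}, {3, 4, 12, 13, 14}, {0, 5, 12, 13, 14}, {3, 5, 12, 13, 14}}

/-- Ways for line 1 to fail without using `S₁`; then the same for the other two lines. -/
def cutA : Finset (Finset (Fin 15)) := {{6}, {7}, {8}, {0, 1}}
def cutB : Finset (Finset (Fin 15)) := {{9}, {10}, {11}, {0, 2}}
def cutC : Finset (Finset (Fin 15)) := {{12}, {13}, {14}, {0, 3}}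

/-- The minimal cut sets. -/
def sfpCuts : Finset (Finset (Fin 15)) :=
  (cutA ×ˢ cutB ×ˢ cutC).image (fun p => p.1 ∪ (p.2.1 ∪ p.2.2)) ∪
    (insert {5} cutC).image (fun c => insert 4 c)

theorem isPathSet_iff (S : Finset (Fin 15)) :
    IsPathSet 15 sfp S ↔ ∃ k ∈ sfpPaths, k ⊆ S := by
  simp only [IsPathSet, sfp, sfpPaths, Finset.mem_insert, Finset.mem_singleton,
    exists_eq_or_imp, exists_eq_left, Finset.insert_subset_iff, Finset.singleton_subset_iff,
    Bool.or_eq_true, Bool.and_eq_true, decide_eq_true_eq]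
  by_cases h0 : 0 ∈ S <;> by_cases h4 : 4 ∈ S <;> by_cases h12 : 12 ∈ S <;>
    simp only [h0, h4, h12, true_and, false_and, and_false, true_or, or_true, false_or, or_false,
      and_true] <;> grind

theorem exists_cut_iff (S : Finset (Fin 15)) :
    (∃ k ∈ sfpCuts, k ⊆ S) ↔
      ((∃ a ∈ cutA, a ⊆ S) ∧ (∃ b ∈ cutB, b ⊆ S) ∧ (∃ c ∈ cutC, c ⊆ S)) ∨
      (4 ∈ S ∧ (5 ∈ S ∨ ∃ c ∈ cutC, c ⊆ S)) := by
  constructor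
  · rintro ⟨k, hk, hkS⟩
    rcases Finset.mem_union.1 hk with h | h
    · obtain ⟨⟨a, b, c⟩, hp, rfl⟩ := Finset.mem_image.1 h
      simp only [Finset.mem_product] at hp
      simp only [Finset.union_subset_iff] at hkS
      exact Or.inl ⟨⟨a, hp.1, hkS.1⟩, ⟨b, hp.2.1, hkS.2.1⟩, ⟨c, hp.2.2, hkS.2.2⟩⟩
    · obtain ⟨c, hc, rfl⟩ := Finset.mem_image.1 h
      rw [Finset.insert_subset_iff] at hkS
      refine Or.inr ⟨hkS.1, ?_⟩
      rcases Finset.mem_insert.1 hc with rfl | hc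
      · exact Or.inl (Finset.singleton_subset_iff.1 hkS.2)
      · exact Or.inr ⟨c, hc, hkS.2⟩
  · rintro (⟨⟨a, ha, haS⟩, ⟨b, hb, hbS⟩, ⟨c, hc, hcS⟩⟩ | ⟨h4, h5 | ⟨c, hc, hcS⟩⟩)
    · exact ⟨a ∪ (b ∪ c), Finset.mem_union_left _ (Finset.mem_image.2
        ⟨(a, b, c), by simp [ha, hb, hc], rfl⟩),
        Finset.union_subset haS (Finset.union_subset hbS hcS)⟩
    · exact ⟨insert 4 {5}, Finset.mem_union_right _ (Finset.mem_image_of_mem _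
        (Finset.mem_insert_self _ _)),
        Finset.insert_subset h4 (Finset.singleton_subset_iff.2 h5)⟩
    · exact ⟨insert 4 c, Finset.mem_union_right _ (Finset.mem_image_of_mem _
        (Finset.mem_insert_of_mem hc)), Finset.insert_subset h4 hcS⟩

theorem isCutSet_iff (S : Finset (Fin 15)) :
    IsCutSet 15 sfp S ↔ ∃ k ∈ sfpCuts, k ⊆ S := by
  rw [exists_cut_iff]
  simp only [IsCutSet, sfp, cutA, cutB, cutC, Finset.mem_insert, Finset.mem_singleton,
    exists_eq_or_imp, exists_eq_left, Finset.insert_subset_iff, Finset.singleton_subset_iff,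
    Bool.or_eq_false_iff, Bool.and_eq_false_iff, decide_eq_false_iff_not, not_not]
  by_cases h0 : 0 ∈ S <;> by_cases h4 : 4 ∈ S <;> simp only [h0, h4, true_and, false_and,
    true_or, or_true, false_or, or_false, and_true] <;> grind

theorem antichain_of_card (K : Finset (Finset (Fin 15)))
    (h : (K.filter (fun k => (K.filter (fun l => l ⊂ k)).card ≠ 0)).card = 0) :
    ∀ k ∈ K, ∀ l ∈ K, k ⊆ l → k = l := by
  intro k hk l hl hkl
  by_contra hne
  rw [Finset.card_eq_zero, Finset.filter_eq_empty_iff] at h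
  refine h hl (Finset.card_ne_zero_of_mem (a := k) ?_)
  exact Finset.mem_filter.2 ⟨hk, hkl.ssubset_of_ne hne⟩

theorem sfpPaths_antichain : ∀ k ∈ sfpPaths, ∀ l ∈ sfpPaths, k ⊆ l → k = l :=
  antichain_of_card _ (by decide +kernel)

theorem sfpCuts_antichain : ∀ k ∈ sfpCuts, ∀ l ∈ sfpCuts, k ⊆ l → k = l :=
  antichain_of_card _ (by decide +kernel)

theorem sfpCuts_card : sfpCuts.card = 69 := by
  decide +kernel

theorem sfp_mono (c c' : Fin 15 → Bool) (h : ∀ j, c j ≤ c' j) : sfp c ≤ sfp c' := by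
  have h' : ∀ j, c j = true → c' j = true := fun j => Bool.le_iff_imp.1 (h j)
  rw [Bool.le_iff_imp]
  simp only [sfp, Bool.or_eq_true, Bool.and_eq_true]
  rintro ((⟨⟨⟨⟨h1, h2⟩, h3⟩, h4⟩, h5⟩ | ⟨⟨⟨⟨h1, h2⟩, h3⟩, h4⟩, h5⟩) | ⟨⟨⟨⟨h1, h2⟩, h3⟩, h4⟩, h5⟩)
  · exact Or.inl (Or.inl ⟨⟨⟨⟨h1.imp (h' _) (h' _), h' _ h2⟩, h' _ h3⟩, h' _ h4⟩, h' _ h5⟩)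
  · exact Or.inl (Or.inr ⟨⟨⟨⟨h1.imp (h' _) (h' _), h' _ h2⟩, h' _ h3⟩, h' _ h4⟩, h' _ h5⟩)
  · exact Or.inr ⟨⟨⟨⟨h1.imp (h' _) (h' _), h2.imp (h' _) (h' _)⟩, h' _ h3⟩, h' _ h4⟩, h' _ h5⟩

/-- the spent fuel pool structure function is coherent, has exactly 8 minimal path
sets and exactly 69 minimal cut sets. -/
theorem sfp_coherent_mps_mcs_count :
    (∀ c c' : Fin 15 → Bool, (∀ j, c j ≤ c' j) → sfp c ≤ sfp c') ∧
    sfp (fun _ => true) = true ∧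
    sfp (fun _ => false) = false ∧
    {S : Finset (Fin 15) | IsMinimalPathSet 15 sfp S}.ncard = 8 ∧
    {S : Finset (Fin 15) | IsMinimalCutSet 15 sfp S}.ncard = 69 := by
  refine ⟨sfp_mono, rfl, rfl, ?_, ?_⟩
  · have h := minimal_eq_of_generates _ sfpPaths isPathSet_iff sfpPaths_antichain
    unfold IsMinimalPathSet
    rw [h, Set.ncard_coe_finset]
    decide +kernel
  · have h := minimal_eq_of_generates _ sfpCuts isCutSet_iff sfpCuts_antichain
    unfold IsMinimalCutSet
    rw [h, Set.ncard_coe_finset, sfpCuts_card]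
end

section
/- Consider a series system with n ≥ 1 components, whose minimal path set is the full component set and whose minimal cut sets are the n singletons. For a mode c ∈ {0,1}^n (1 = working, 0 = broken), let β(c) be the number of broken components. Then for every θ = (θ_1, …, θ_n) ∈ ℝⁿ: (i) the MCS-based importance function coincides with the broken-components importance function, U_θ^{(MCS)}(c) = exp((∑_{i=1}^{β(c)} θ_i)²) = U_θ^{(BC)}(c) — equivalently, the proportions of broken components within the n singleton minimal cut sets, sorted in descending order, satisfy ∑_{i=1}^{n} θ_i β_{(i)}^{(MCS)}(c) = ∑_{i=1}^{β(c)} θ_i; and (ii) the MPS-based importance function equals U_θ^{(MPS)}(c) = exp(θ_1² · 1_{β(c) ≥ 1}). -/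
/-- in a series system with `n` components (minimal cut sets = the `n` singletons,
minimal path set = the full set), for a mode `c` with `β(c)` broken components:
(i) the descending rearrangement `sorted` of the vector of proportions of broken components of
the singleton minimal cut sets satisfies `∑_i θ_i · sorted_i = ∑_{i=1}^{β(c)} θ_i`, so the
MCS-based importance function coincides with the broken-components one; and
(ii) the MPS-based importance function (built on `βMPS`, the number of damaged minimal path
sets, here `1_{β(c) ≥ 1}`) equals `exp(θ₁² · 1_{β(c) ≥ 1})`. -/
theorem series_importance_functions
    (n : ℕ) (hn : 1 ≤ n) (θ : Fin n → ℝ) (c : Fin n → Bool)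
    (β : ℕ) (hβ : β = (Finset.univ.filter fun j : Fin n => c j = false).card)
    (props : Fin n → ℝ) (hprops : props = fun j => if c j then 0 else 1)
    (sorted : Fin n → ℝ) (hanti : Antitone sorted)
    (hperm : ∃ σ : Equiv.Perm (Fin n), sorted = props ∘ σ) :
    ((∑ i : Fin n, θ i * sorted i)
        = ∑ i ∈ Finset.univ.filter (fun i : Fin n => (i : ℕ) < β), θ i ∧
      Real.exp ((∑ i : Fin n, θ i * sorted i) ^ 2)
        = Real.exp ((∑ i ∈ Finset.univ.filter (fun i : Fin n => (i : ℕ) < β), θ i) ^ 2)) ∧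
    (∀ βMPS : ℕ, βMPS = (if ∃ j, c j = false then 1 else 0) →
      Real.exp ((∑ i ∈ Finset.univ.filter (fun i : Fin n => (i : ℕ) < βMPS), θ i) ^ 2)
        = Real.exp (θ ⟨0, hn⟩ ^ 2 * (if 1 ≤ β then (1 : ℝ) else 0))) := by
  obtain ⟨σ, hσ⟩ := hperm
  have hs : ∀ i, sorted i = if c (σ i) = false then 1 else 0 := by
    intro i
    rw [hσ, hprops]
    cases h : c (σ i) <;> simp [h]
  have hcard : (Finset.univ.filter fun i : Fin n => c (σ i) = false).card = β := by
    rw [hβ]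
    refine Finset.card_bij (fun i _ => σ i) ?_ ?_ ?_
    · intro a ha
      simpa using ha
    · intro a _ b _ h
      exact σ.injective h
    · intro b hb
      exact ⟨σ.symm b, by simpa using hb, by simp⟩
  have hST : (Finset.univ.filter fun i : Fin n => c (σ i) = false)
      = Finset.univ.filter (fun i : Fin n => (i : ℕ) < β) := by
    apply Finset.eq_of_subset_of_card_le
    · intro i hi
      have hi' : c (σ i) = false := by simpa using hi
      have hsub : Finset.Iic i ⊆ Finset.univ.filter fun i : Fin n => c (σ i) = false := by
        intro j hj
        have hle := hanti (Finset.mem_Iic.mp hj)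
        rw [hs, hs, if_pos hi'] at hle
        by_contra hc
        have hc' : ¬ c (σ j) = false := by simpa using hc
        rw [if_neg hc'] at hle
        linarith
      have h2 := Finset.card_le_card hsub
      rw [hcard, Fin.card_Iic] at h2
      simp only [Finset.mem_filter, Finset.mem_univ, true_and]
      omega
    · rw [hcard]
      calc _ ≤ (Finset.range β).card :=
            Finset.card_le_card_of_injOn (fun i : Fin n => (i : ℕ))
              (by intro i hi; simpa using hi) (by intro a _ b _ h; exact Fin.ext h)
        _ = β := Finset.card_range β
  have hmain : (∑ i : Fin n, θ i * sorted i)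
      = ∑ i ∈ Finset.univ.filter (fun i : Fin n => (i : ℕ) < β), θ i := by
    rw [← hST, Finset.sum_filter]
    refine Finset.sum_congr rfl fun i _ => ?_
    rw [hs]
    split_ifs <;> simp
  refine ⟨⟨hmain, by rw [hmain]⟩, ?_⟩
  intro m hm
  have hiff : (1 ≤ β) ↔ ∃ j, c j = false := by
    rw [hβ, Nat.succ_le_iff, Finset.card_pos]
    simp [Finset.Nonempty]
  by_cases h : ∃ j, c j = false
  · rw [if_pos h] at hm
    rw [if_pos (hiff.mpr h), hm]
    have : Finset.univ.filter (fun i : Fin n => (i : ℕ) < 1) = {⟨0, hn⟩} := by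
      ext i
      simp [Fin.ext_iff]
    rw [this]
    simp
  · rw [if_neg h] at hm
    rw [if_neg (fun h' => h (hiff.mp h')), hm]
    simp
end
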